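/- arXiv:1912.08050 — 3 statements merged into one kernel-verified Lean document; each statement's English description precedes it below -/
import Mathlib

section
/- Let α, γ, ν > 0 and h ∈ (0,1). Let Z, V, V′ be random variables on a probability space, all taking values in [0,1], such that E[Z] = h, Var(Z) = h(1−h)/(α+1), and, almost surely, E[V | σ(Z)] = E[V′ | σ(Z)] = Z, E[V² | σ(Z)] = E[V′² | σ(Z)] = Z² + Z(1−Z)/(γ+1), and E[V·V′ | σ(Z)] = (1/(1+ν))·(Z² + Z(1−Z)/(γ+1)) + (ν/(1+ν))·Z². Then Cov(V, V′) = h(1−h)·(νγ+α+γ+ν+1) / ((ν+1)(α+1)(γ+1)), and consequently the correlation of V and V′ equals (1/(1+ν)) · (νγ+α+γ+ν+1)/(α+γ+1). -/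
open MeasureTheory ProbabilityTheory

theorem stmt_1 {Ω : Type*} [MeasurableSpace Ω] (P : Measure Ω) [IsProbabilityMeasure P]
    (α γ ν h : ℝ) (hα : 0 < α) (hγ : 0 < γ) (hν : 0 < ν) (hh : h ∈ Set.Ioo (0 : ℝ) 1)
    (Z V V' : Ω → ℝ) (hZm : Measurable Z) (hVm : Measurable V) (hV'm : Measurable V')
    (hZ01 : ∀ᵐ ω ∂P, Z ω ∈ Set.Icc (0 : ℝ) 1)
    (hV01 : ∀ᵐ ω ∂P, V ω ∈ Set.Icc (0 : ℝ) 1)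
    (hV'01 : ∀ᵐ ω ∂P, V' ω ∈ Set.Icc (0 : ℝ) 1)
    (hZmean : ∫ ω, Z ω ∂P = h)
    (hZvar : variance Z P = h * (1 - h) / (α + 1))
    (hVcond : P[V | MeasurableSpace.comap Z inferInstance] =ᵐ[P] Z)
    (hV'cond : P[V' | MeasurableSpace.comap Z inferInstance] =ᵐ[P] Z)
    (hV2cond : P[(fun ω => V ω ^ 2) | MeasurableSpace.comap Z inferInstance]
        =ᵐ[P] fun ω => Z ω ^ 2 + Z ω * (1 - Z ω) / (γ + 1))
    (hV'2cond : P[(fun ω => V' ω ^ 2) | MeasurableSpace.comap Z inferInstance]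
        =ᵐ[P] fun ω => Z ω ^ 2 + Z ω * (1 - Z ω) / (γ + 1))
    (hVV'cond : P[(fun ω => V ω * V' ω) | MeasurableSpace.comap Z inferInstance]
        =ᵐ[P] fun ω => (1 / (1 + ν)) * (Z ω ^ 2 + Z ω * (1 - Z ω) / (γ + 1))
          + (ν / (1 + ν)) * Z ω ^ 2) :
    ∫ ω, V ω * V' ω ∂P - (∫ ω, V ω ∂P) * (∫ ω, V' ω ∂P)
        = h * (1 - h) * (ν * γ + α + γ + ν + 1) / ((ν + 1) * (α + 1) * (γ + 1)) ∧
      (∫ ω, V ω * V' ω ∂P - (∫ ω, V ω ∂P) * (∫ ω, V' ω ∂P)) /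
          (Real.sqrt (variance V P) * Real.sqrt (variance V' P))
        = (1 / (1 + ν)) * ((ν * γ + α + γ + ν + 1) / (α + γ + 1)) := by
  obtain ⟨h0, h1⟩ := hh
  have hle : MeasurableSpace.comap Z inferInstance ≤ (inferInstance : MeasurableSpace Ω) :=
    hZm.comap_le
  have hZL : MemLp Z 2 P := memLp_of_bounded hZ01 hZm.aestronglyMeasurable 2
  have hVL : MemLp V 2 P := memLp_of_bounded hV01 hVm.aestronglyMeasurable 2
  have hVL' : MemLp V' 2 P := memLp_of_bounded hV'01 hV'm.aestronglyMeasurable 2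
  have iZ : Integrable Z P := hZL.integrable (by norm_num)
  have iZ2 : Integrable (fun ω => Z ω ^ 2) P := hZL.integrable_sq
  have key : ∀ f g : Ω → ℝ, P[f | MeasurableSpace.comap Z inferInstance] =ᵐ[P] g →
      ∫ ω, f ω ∂P = ∫ ω, g ω ∂P := by
    intro f g hfg
    rw [← integral_condExp hle, integral_congr_ae hfg]
  have lin : ∀ a b : ℝ, ∫ ω, (a * Z ω ^ 2 + b * Z ω) ∂P = a * ∫ ω, Z ω ^ 2 ∂P + b * h := by
    intro a b
    rw [integral_add (iZ2.const_mul a) (iZ.const_mul b), integral_const_mul, integral_const_mul,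
      hZmean]
  have vZ := variance_eq_sub hZL
  have vV := variance_eq_sub hVL
  have vV' := variance_eq_sub hVL'
  simp only [Pi.pow_apply] at vZ vV vV'
  have hm : ∫ ω, Z ω ^ 2 ∂P = h ^ 2 + h * (1 - h) / (α + 1) := by
    rw [hZvar, hZmean] at vZ
    linarith
  have eV := key _ _ hVcond
  have eV' := key _ _ hV'cond
  have e2 : ∫ ω, (Z ω ^ 2 + Z ω * (1 - Z ω) / (γ + 1)) ∂P
      = (1 - 1 / (γ + 1)) * ∫ ω, Z ω ^ 2 ∂P + 1 / (γ + 1) * h := by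
    rw [← lin]
    congr 1
    ext ω
    ring
  have e3 : ∫ ω, ((1 / (1 + ν)) * (Z ω ^ 2 + Z ω * (1 - Z ω) / (γ + 1))
          + (ν / (1 + ν)) * Z ω ^ 2) ∂P
      = (1 / (1 + ν) * (1 - 1 / (γ + 1)) + ν / (1 + ν)) * ∫ ω, Z ω ^ 2 ∂P
        + 1 / (1 + ν) * (1 / (γ + 1)) * h := by
    rw [← lin]
    congr 1
    ext ω
    ring
  have hα1 : α + 1 ≠ 0 := by positivity
  have hγ1 : γ + 1 ≠ 0 := by positivity
  have hν1 : ν + 1 ≠ 0 := by positivity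
  have hν2 : 1 + ν ≠ 0 := by positivity
  have hs : α + γ + 1 ≠ 0 := by positivity
  have h1' : 1 - h ≠ 0 := by linarith
  have fV : variance V P = h * (1 - h) * (α + γ + 1) / ((α + 1) * (γ + 1)) := by
    rw [vV, key _ _ hV2cond, e2, hm, eV, hZmean]
    field_simp
    ring
  have fV' : variance V' P = h * (1 - h) * (α + γ + 1) / ((α + 1) * (γ + 1)) := by
    rw [vV', key _ _ hV'2cond, e2, hm, eV', hZmean]
    field_simp
    ring
  have hc : ∫ ω, V ω * V' ω ∂P - (∫ ω, V ω ∂P) * (∫ ω, V' ω ∂P)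
        = h * (1 - h) * (ν * γ + α + γ + ν + 1) / ((ν + 1) * (α + 1) * (γ + 1)) := by
    rw [key _ _ hVV'cond, e3, hm, eV, eV', hZmean]
    field_simp
    ring
  refine ⟨hc, ?_⟩
  rw [hc, fV, fV', Real.mul_self_sqrt]
  · field_simp
    try ring
  · have : 0 < 1 - h := by linarith
    positivity
end

section
/- Let α, γ, ν > 0 and let H be a probability measure on ℝ with finite second moment and strictly positive variance. Let ξ, ξ′ be random variables each with law H, let B₀, B₁, B₂ be Bernoulli random variables with success probabilities 1/(1+ν), 1/(1+γ), 1/(1+α) respectively, and suppose ξ, ξ′, B₀, B₁, B₂ are jointly independent. Define μ = ξ, and μ′ = ξ on the event ({B₀ = 1} ∩ ({B₁ = 1} ∪ {B₂ = 1})) ∪ ({B₀ = 0} ∩ {B₂ = 1}) and μ′ = ξ′ otherwise. Then μ′ has law H and Cor(μ, μ′) = (νγ+α+γ+ν+1) / ((ν+1)(α+1)(γ+1)). -/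
open MeasureTheory ProbabilityTheory

theorem stmt_3 {Ω : Type*} [MeasurableSpace Ω] (P : Measure Ω) [IsProbabilityMeasure P]
    (α γ ν : ℝ) (hα : 0 < α) (hγ : 0 < γ) (hν : 0 < ν)
    (H : Measure ℝ) [IsProbabilityMeasure H]
    (hH2 : MemLp (fun x : ℝ => x) 2 H)
    (hHvar : 0 < ∫ x, x ^ 2 ∂H - (∫ x, x ∂H) ^ 2)
    (ξ ξ' B₀ B₁ B₂ : Ω → ℝ)
    (hξm : Measurable ξ) (hξ'm : Measurable ξ')
    (hB₀m : Measurable B₀) (hB₁m : Measurable B₁) (hB₂m : Measurable B₂)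
    (hξlaw : P.map ξ = H) (hξ'law : P.map ξ' = H)
    (hB₀01 : ∀ ω, B₀ ω = 0 ∨ B₀ ω = 1)
    (hB₁01 : ∀ ω, B₁ ω = 0 ∨ B₁ ω = 1) (hB₂01 : ∀ ω, B₂ ω = 0 ∨ B₂ ω = 1)
    (hB₀p : P {ω | B₀ ω = 1} = ENNReal.ofReal (1 / (1 + ν)))
    (hB₁p : P {ω | B₁ ω = 1} = ENNReal.ofReal (1 / (1 + γ)))
    (hB₂p : P {ω | B₂ ω = 1} = ENNReal.ofReal (1 / (1 + α)))
    (hindep : iIndepFun ![ξ, ξ', B₀, B₁, B₂] P)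
    (μ μ' : Ω → ℝ)
    (hμ : μ = ξ)
    (hμ' : μ' = fun ω =>
      if (B₀ ω = 1 ∧ (B₁ ω = 1 ∨ B₂ ω = 1)) ∨ (B₀ ω = 0 ∧ B₂ ω = 1) then ξ ω else ξ' ω) :
    P.map μ' = H ∧
      (∫ ω, μ ω * μ' ω ∂P - (∫ ω, μ ω ∂P) * (∫ ω, μ' ω ∂P)) /
          (Real.sqrt (variance μ P) * Real.sqrt (variance μ' P))
        = (ν * γ + α + γ + ν + 1) / ((ν + 1) * (α + 1) * (γ + 1)) := by
  have hm : ∀ i, Measurable ((![ξ, ξ', B₀, B₁, B₂] : Fin 5 → Ω → ℝ) i) := by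
    intro i; fin_cases i <;> simpa
  set t : Ω → ℝ := fun ω => B₀ ω * (B₁ ω + B₂ ω - B₁ ω * B₂ ω) + (1 - B₀ ω) * B₂ ω with ht
  have htm : Measurable t := by fun_prop
  have ht01 : ∀ ω, t ω = 0 ∨ t ω = 1 := by
    intro ω
    simp only [ht]
    rcases hB₀01 ω with h0 | h0 <;> rcases hB₁01 ω with h1 | h1 <;>
      rcases hB₂01 ω with h2 | h2 <;> simp [h0, h1, h2]
  have hμt : ∀ ω, μ' ω = if t ω = 1 then ξ ω else ξ' ω := by
    intro ω
    simp only [hμ', ht]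
    rcases hB₀01 ω with h0 | h0 <;> rcases hB₁01 ω with h1 | h1 <;>
      rcases hB₂01 ω with h2 | h2 <;> simp [h0, h1, h2]
  have hind : IndepFun (fun ω => (ξ ω, ξ' ω)) t P := by
    have h := hindep.indepFun_finset {0, 1} {2, 3, 4} (by decide) hm
    have h2 := h.comp
      (φ := fun f : (({0, 1} : Finset (Fin 5)) → ℝ) =>
        (f ⟨0, by decide⟩, f ⟨1, by decide⟩))
      (ψ := fun f : (({2, 3, 4} : Finset (Fin 5)) → ℝ) =>
        f ⟨2, by decide⟩ * (f ⟨3, by decide⟩ + f ⟨4, by decide⟩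
          - f ⟨3, by decide⟩ * f ⟨4, by decide⟩) + (1 - f ⟨2, by decide⟩) * f ⟨4, by decide⟩)
      (by fun_prop) (by fun_prop)
    exact h2
  have hξξ' : IndepFun ξ ξ' P := hindep.indepFun (i := 0) (j := 1) (by decide)
  have hμ'm : Measurable μ' := by
    have : μ' = fun ω => if t ω = 1 then ξ ω else ξ' ω := funext hμt
    rw [this]
    exact Measurable.ite (htm (measurableSet_singleton 1)) hξm hξ'm
  have hlaw : P.map μ' = H := by
    ext A hA
    rw [Measure.map_apply hμ'm hA]
    have hT : MeasurableSet (t ⁻¹' {1}) := htm (measurableSet_singleton 1)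
    rw [← measure_inter_add_sdiff (μ' ⁻¹' A) hT]
    have e1 : μ' ⁻¹' A ∩ t ⁻¹' {1} = ξ ⁻¹' A ∩ t ⁻¹' {1} := by
      ext ω
      simp only [Set.mem_inter_iff, Set.mem_preimage, Set.mem_singleton_iff, hμt]
      constructor <;> rintro ⟨a, b⟩ <;> simp_all
    have e2 : μ' ⁻¹' A \ t ⁻¹' {1} = ξ' ⁻¹' A ∩ t ⁻¹' {1}ᶜ := by
      ext ω
      simp only [Set.mem_inter_iff, Set.mem_sdiff, Set.mem_preimage, Set.mem_singleton_iff,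
        Set.mem_compl_iff, hμt]
      constructor <;> rintro ⟨a, b⟩ <;> simp_all
    have i1 : IndepFun ξ t P := hind.comp (φ := Prod.fst) (ψ := id) measurable_fst measurable_id
    have i2 : IndepFun ξ' t P := hind.comp (φ := Prod.snd) (ψ := id) measurable_snd measurable_id
    rw [e1, e2, i1.measure_inter_preimage_eq_mul _ _ hA (measurableSet_singleton 1),
      i2.measure_inter_preimage_eq_mul _ _ hA (measurableSet_singleton 1).compl,
      ← Measure.map_apply hξm hA, ← Measure.map_apply hξ'm hA, hξlaw, hξ'law, ← mul_add,
      Set.preimage_compl, measure_add_measure_compl hT, measure_univ, mul_one]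
  refine ⟨hlaw, ?_⟩
  have hint : ∀ X : Ω → ℝ, Measurable X → P.map X = H →
      MemLp X 2 P ∧ ∫ ω, X ω ∂P = ∫ x, x ∂H ∧ ∫ ω, X ω ^ 2 ∂P = ∫ x, x ^ 2 ∂H := by
    intro X hX hl
    subst hl
    refine ⟨?_, ?_, ?_⟩
    · exact (memLp_map_measure_iff aestronglyMeasurable_id hX.aemeasurable).1 hH2
    · rw [integral_map hX.aemeasurable (by fun_prop)]
    · rw [integral_map hX.aemeasurable (by fun_prop)]
  have hvar : ∀ X : Ω → ℝ, Measurable X → P.map X = H →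
      variance X P = ∫ x, x ^ 2 ∂H - (∫ x, x ∂H) ^ 2 := by
    intro X hX hl
    obtain ⟨a, b, c⟩ := hint X hX hl
    rw [variance_eq_sub a, b, ← c]
    rfl
  subst hμ
  obtain ⟨a, b, c⟩ := hint μ hξm hξlaw
  obtain ⟨a', b', c'⟩ := hint ξ' hξ'm hξ'law
  obtain ⟨_, b'', _⟩ := hint μ' hμ'm hlaw
  rw [hvar μ hξm hξlaw, hvar μ' hμ'm hlaw, b, b'', Real.mul_self_sqrt hHvar.le]
  have hbd : ∀ B : Ω → ℝ, Measurable B → (∀ ω, B ω = 0 ∨ B ω = 1) → ∀ q : ℝ, 0 < q →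
      P {ω | B ω = 1} = ENNReal.ofReal (1 / (1 + q)) →
      Integrable B P ∧ ∫ ω, B ω ∂P = 1 / (1 + q) := by
    intro B hB h01 q hq hp
    have hs : MeasurableSet {ω | B ω = 1} := hB (measurableSet_singleton 1)
    have e : B = Set.indicator {ω | B ω = 1} 1 := by
      ext ω
      rcases h01 ω with h | h <;> simp [Set.indicator, h]
    constructor
    · rw [e]
      exact (integrable_const (1 : ℝ)).indicator hs
    · rw [e, integral_indicator_one hs, measureReal_def, hp, ENNReal.toReal_ofReal (by positivity)]
  obtain ⟨I0, E0⟩ := hbd B₀ hB₀m hB₀01 ν hν hB₀p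
  obtain ⟨I1, E1⟩ := hbd B₁ hB₁m hB₁01 γ hγ hB₁p
  obtain ⟨I2, E2⟩ := hbd B₂ hB₂m hB₂01 α hα hB₂p
  have i01 : IndepFun B₀ B₁ P := hindep.indepFun (i := 2) (j := 3) (by decide)
  have i02 : IndepFun B₀ B₂ P := hindep.indepFun (i := 2) (j := 4) (by decide)
  have i012 : IndepFun (fun ω => B₀ ω * B₁ ω) B₂ P :=
    hindep.indepFun_mul_left hm 2 3 4 (by decide) (by decide)
  have I01 : Integrable (fun ω => B₀ ω * B₁ ω) P := i01.integrable_mul I0 I1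
  have I012 : Integrable (fun ω => B₀ ω * B₁ ω * B₂ ω) P := i012.integrable_mul I01 I2
  have E01 : ∫ ω, B₀ ω * B₁ ω ∂P = 1 / (1 + ν) * (1 / (1 + γ)) := by
    rw [← E0, ← E1]
    exact i01.integral_mul_eq_mul_integral I0.1 I1.1
  have E012 : ∫ ω, B₀ ω * B₁ ω * B₂ ω ∂P = 1 / (1 + ν) * (1 / (1 + γ)) * (1 / (1 + α)) := by
    rw [← E01, ← E2]
    exact i012.integral_mul_eq_mul_integral I01.1 I2.1
  have ht' : t = fun ω => B₀ ω * B₁ ω - B₀ ω * B₁ ω * B₂ ω + B₂ ω := by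
    ext ω; simp only [ht]; ring
  have It : Integrable t P := by
    rw [ht']; exact (I01.sub I012).add I2
  have Et : ∫ ω, t ω ∂P = 1 / (1 + ν) * (1 / (1 + γ)) -
      1 / (1 + ν) * (1 / (1 + γ)) * (1 / (1 + α)) + 1 / (1 + α) := by
    have I3 : Integrable (fun ω => B₀ ω * B₁ ω - B₀ ω * B₁ ω * B₂ ω) P := I01.sub I012
    simp only [ht']
    rw [integral_add I3 I2, integral_sub I01 I012, E01, E012, E2]
  have Isq : Integrable (fun ω => μ ω ^ 2) P := a.integrable_sq
  have Ia : Integrable μ P := a.integrable (by norm_num)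
  have Ia' : Integrable ξ' P := a'.integrable (by norm_num)
  have Ip : Integrable (fun ω => μ ω * ξ' ω) P := hξξ'.integrable_mul Ia Ia'
  have Ep : ∫ ω, μ ω * ξ' ω ∂P = (∫ x, x ∂H) * (∫ x, x ∂H) := by
    nth_rw 1 [← b]
    rw [← b']
    exact hξξ'.integral_mul_eq_mul_integral Ia.1 Ia'.1
  have j1 : IndepFun (fun ω => μ ω ^ 2 - μ ω * ξ' ω) t P :=
    hind.comp (φ := fun p : ℝ × ℝ => p.1 ^ 2 - p.1 * p.2) (ψ := id) (by fun_prop) measurable_id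
  have Id : Integrable (fun ω => μ ω ^ 2 - μ ω * ξ' ω) P := Isq.sub Ip
  have Idt : Integrable (fun ω => (μ ω ^ 2 - μ ω * ξ' ω) * t ω) P := j1.integrable_mul Id It
  have Edt : ∫ ω, (μ ω ^ 2 - μ ω * ξ' ω) * t ω ∂P =
      (∫ ω, (μ ω ^ 2 - μ ω * ξ' ω) ∂P) * ∫ ω, t ω ∂P :=
    j1.integral_mul_eq_mul_integral Id.1 It.1
  have em : (fun ω => μ ω * μ' ω) = fun ω => (μ ω ^ 2 - μ ω * ξ' ω) * t ω + μ ω * ξ' ω := by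
    ext ω
    rw [hμt]
    rcases ht01 ω with h | h <;> simp [h]
    ring
  rw [em, integral_add Idt Ip, Edt, integral_sub Isq Ip, c, Ep, Et]
  have hne := hHvar.ne'
  rw [div_eq_iff hne]
  field_simp
  ring
end

section
/- Let α, γ, ν > 0, let D ≥ 2, and let H be a probability measure on ℝᴰ whose coordinates are square integrable. Let ξ, ξ′ be ℝᴰ-valued random variables each with law H, let B₀, B₁, B₂ be Bernoulli random variables with success probabilities 1/(1+ν), 1/(1+γ), 1/(1+α) respectively, and suppose ξ, ξ′, B₀, B₁, B₂ are jointly independent. Define μ = ξ, and μ′ = ξ on the event ({B₀ = 1} ∩ ({B₁ = 1} ∪ {B₂ = 1})) ∪ ({B₀ = 0} ∩ {B₂ = 1}) and μ′ = ξ′ otherwise. Then for all coordinates g, g′ ∈ {1,…,D}, Cov(μ_g, μ′_{g′}) = ((νγ+α+γ+ν+1)/((ν+1)(α+1)(γ+1))) · Cov_H(g, g′), where Cov_H(g, g′) is the (g, g′) entry of the covariance matrix of H. In particular, if every coordinate of H has strictly positive variance, the correlation matrix between μ and μ′ equals ((νγ+α+γ+ν+1)/((ν+1)(α+1)(γ+1)))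 · R_H, where R_H is the correlation matrix of H. -/
open MeasureTheory ProbabilityTheory

theorem stmt_5 {Ω : Type*} [MeasurableSpace Ω] (P : Measure Ω) [IsProbabilityMeasure P]
    (α γ ν : ℝ) (hα : 0 < α) (hγ : 0 < γ) (hν : 0 < ν)
    (D : ℕ) (hD : 2 ≤ D)
    (H : Measure (Fin D → ℝ)) [IsProbabilityMeasure H]
    (hH2 : ∀ g : Fin D, MemLp (fun x : Fin D → ℝ => x g) 2 H)
    (ξ ξ' : Ω → (Fin D → ℝ)) (B₀ B₁ B₂ : Ω → ℝ)
    (hξm : Measurable ξ) (hξ'm : Measurable ξ')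
    (hB₀m : Measurable B₀) (hB₁m : Measurable B₁) (hB₂m : Measurable B₂)
    (hξlaw : P.map ξ = H) (hξ'law : P.map ξ' = H)
    (hB₀01 : ∀ ω, B₀ ω = 0 ∨ B₀ ω = 1)
    (hB₁01 : ∀ ω, B₁ ω = 0 ∨ B₁ ω = 1) (hB₂01 : ∀ ω, B₂ ω = 0 ∨ B₂ ω = 1)
    (hB₀p : P {ω | B₀ ω = 1} = ENNReal.ofReal (1 / (1 + ν)))
    (hB₁p : P {ω | B₁ ω = 1} = ENNReal.ofReal (1 / (1 + γ)))
    (hB₂p : P {ω | B₂ ω = 1} = ENNReal.ofReal (1 / (1 + α)))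
    (hindep : iIndepFun
      ![fun ω => ξ ω, fun ω => ξ' ω,
        fun ω _ => B₀ ω, fun ω _ => B₁ ω, fun ω _ => B₂ ω] P)
    (μ μ' : Ω → (Fin D → ℝ))
    (hμ : μ = ξ)
    (hμ' : μ' = fun ω =>
      if (B₀ ω = 1 ∧ (B₁ ω = 1 ∨ B₂ ω = 1)) ∨ (B₀ ω = 0 ∧ B₂ ω = 1) then ξ ω else ξ' ω)
    -- covariance matrix entries of H
    (CovH : Fin D → Fin D → ℝ)
    (hCovH : ∀ g g', CovH g g'
      = ∫ x, x g * x g' ∂H - (∫ x, x g ∂H) * (∫ x, x g' ∂H)) :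
    (∀ g g' : Fin D,
        ∫ ω, μ ω g * μ' ω g' ∂P - (∫ ω, μ ω g ∂P) * (∫ ω, μ' ω g' ∂P)
          = (ν * γ + α + γ + ν + 1) / ((ν + 1) * (α + 1) * (γ + 1)) * CovH g g') ∧
      ((∀ g : Fin D, 0 < CovH g g) →
        ∀ g g' : Fin D,
          (∫ ω, μ ω g * μ' ω g' ∂P - (∫ ω, μ ω g ∂P) * (∫ ω, μ' ω g' ∂P)) /
              (Real.sqrt (variance (fun ω => μ ω g) P)
                * Real.sqrt (variance (fun ω => μ' ω g') P))
            = (ν * γ + α + γ + ν + 1) / ((ν + 1) * (α + 1) * (γ + 1))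
                * (CovH g g' / (Real.sqrt (CovH g g) * Real.sqrt (CovH g' g')))) := by
  have hD0 : 0 < D := by omega
  let z : Fin D := ⟨0, hD0⟩
  have hXm : ∀ i : Fin 5, Measurable ((![fun ω => ξ ω, fun ω => ξ' ω,
        fun ω _ => B₀ ω, fun ω _ => B₁ ω, fun ω _ => B₂ ω] : Fin 5 → Ω → Fin D → ℝ) i) := by
    intro i
    fin_cases i
    · exact hξm
    · exact hξ'm
    · exact measurable_pi_lambda _ (fun _ => hB₀m)
    · exact measurable_pi_lambda _ (fun _ => hB₁m)
    · exact measurable_pi_lambda _ (fun _ => hB₂m)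
  have hz : Measurable (fun x : Fin D → ℝ => x z) := measurable_pi_apply z
  have i01 : IndepFun ξ ξ' P := hindep.indepFun (i := 0) (j := 1) (by decide)
  have iB01 : IndepFun B₀ B₁ P :=
    (hindep.indepFun (i := 2) (j := 3) (by decide)).comp hz hz
  have iB012 : IndepFun (fun ω => B₀ ω * B₁ ω) B₂ P :=
    (hindep.indepFun_prodMk hXm 2 3 4 (by decide) (by decide)).comp
      (φ := fun q : (Fin D → ℝ) × (Fin D → ℝ) => q.1 z * q.2 z)
      (by fun_prop) hz
  let t : Ω → ℝ := fun ω => B₀ ω * B₁ ω + B₂ ω - B₀ ω * B₁ ω * B₂ ω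
  have htm : Measurable t := by fun_prop
  have iT : IndepFun (fun ω => (ξ ω, ξ' ω)) t P := by
    have h := hindep.indepFun_finset {0, 1} {2, 3, 4} (by decide) hXm
    exact h.comp
      (φ := fun q : (({0, 1} : Finset (Fin 5)) → Fin D → ℝ) => (q ⟨0, by decide⟩, q ⟨1, by decide⟩))
      (ψ := fun q : (({2, 3, 4} : Finset (Fin 5)) → Fin D → ℝ) => q ⟨2, by decide⟩ z * q ⟨3, by decide⟩ z + q ⟨4, by decide⟩ z
        - q ⟨2, by decide⟩ z * q ⟨3, by decide⟩ z * q ⟨4, by decide⟩ z)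
      (by fun_prop) (by fun_prop)
  have hE : ∀ (B : Ω → ℝ) (c : ℝ), 0 < c → Measurable B → (∀ ω, B ω = 0 ∨ B ω = 1) →
      P {ω | B ω = 1} = ENNReal.ofReal (1 / (1 + c)) → ∫ ω, B ω ∂P = 1 / (1 + c) := by
    intro B c hc hBm h01 hp
    have hs : MeasurableSet {ω | B ω = 1} := hBm (measurableSet_singleton 1)
    have : B = Set.indicator {ω | B ω = 1} (fun _ => (1 : ℝ)) := by
      funext ω
      rcases h01 ω with h | h <;> simp [Set.indicator, h]
    rw [this, integral_indicator_const _ hs, Measure.real, hp,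
      ENNReal.toReal_ofReal (by positivity)]
    simp
  have e0 := hE B₀ ν hν hB₀m hB₀01 hB₀p
  have e1 := hE B₁ γ hγ hB₁m hB₁01 hB₁p
  have e2 := hE B₂ α hα hB₂m hB₂01 hB₂p
  have hbd : ∀ f : Ω → ℝ, Measurable f → (∀ ω, f ω = 0 ∨ f ω = 1) → Integrable f P := by
    intro f hf h
    refine Integrable.of_bound hf.aestronglyMeasurable 1 (Filter.Eventually.of_forall fun ω => ?_)
    rcases h ω with h | h <;> simp [h]
  have h01 : ∀ ω, B₀ ω * B₁ ω = 0 ∨ B₀ ω * B₁ ω = 1 := by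
    intro ω
    rcases hB₀01 ω with h | h <;> rcases hB₁01 ω with h' | h' <;> simp [h, h']
  have h012 : ∀ ω, B₀ ω * B₁ ω * B₂ ω = 0 ∨ B₀ ω * B₁ ω * B₂ ω = 1 := by
    intro ω
    rcases h01 ω with h | h <;> rcases hB₂01 ω with h' | h' <;> simp [h, h']
  have ht01 : ∀ ω, t ω = 0 ∨ t ω = 1 := by
    intro ω
    rcases h01 ω with h | h <;> rcases hB₂01 ω with h' | h' <;> simp [t, h, h']
  have hti : Integrable t P := hbd t htm ht01
  have j01 : Integrable (fun ω => B₀ ω * B₁ ω) P := hbd _ (hB₀m.mul hB₁m) h01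
  have j012 : Integrable (fun ω => B₀ ω * B₁ ω * B₂ ω) P := hbd _ ((hB₀m.mul hB₁m).mul hB₂m) h012
  have j2 := hbd _ hB₂m hB₂01
  obtain ⟨p, hp⟩ : ∃ p : ℝ,
    p = (ν * γ + α + γ + ν + 1) / ((ν + 1) * (α + 1) * (γ + 1)) := ⟨_, rfl⟩
  have et : ∫ ω, t ω ∂P = p := by
    have a1 : ∫ ω, B₀ ω * B₁ ω ∂P = (∫ ω, B₀ ω ∂P) * ∫ ω, B₁ ω ∂P :=
      iB01.integral_fun_mul_eq_mul_integral hB₀m.aestronglyMeasurable hB₁m.aestronglyMeasurable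
    have a2 : ∫ ω, B₀ ω * B₁ ω * B₂ ω ∂P = (∫ ω, B₀ ω * B₁ ω ∂P) * ∫ ω, B₂ ω ∂P :=
      iB012.integral_fun_mul_eq_mul_integral (hB₀m.mul hB₁m).aestronglyMeasurable
        hB₂m.aestronglyMeasurable
    have a3 : ∫ ω, t ω ∂P = ∫ ω, B₀ ω * B₁ ω ∂P + ∫ ω, B₂ ω ∂P
        - ∫ ω, B₀ ω * B₁ ω * B₂ ω ∂P := by
      rw [← integral_add j01 j2, ← integral_sub (by exact j01.add j2) j012]
    rw [a3, a2, a1, e0, e1, e2, hp]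
    field_simp
    ring
  have key : ∀ F G : (Fin D → ℝ) × (Fin D → ℝ) → ℝ, Measurable F → Measurable G →
      Integrable (fun ω => F (ξ ω, ξ' ω)) P → Integrable (fun ω => G (ξ ω, ξ' ω)) P →
      ∫ ω, (if (B₀ ω = 1 ∧ (B₁ ω = 1 ∨ B₂ ω = 1)) ∨ (B₀ ω = 0 ∧ B₂ ω = 1)
        then F (ξ ω, ξ' ω) else G (ξ ω, ξ' ω)) ∂P
      = p * ∫ ω, F (ξ ω, ξ' ω) ∂P + (1 - p) * ∫ ω, G (ξ ω, ξ' ω) ∂P := by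
    intro F G hF hG hFi hGi
    have iF : IndepFun (fun ω => F (ξ ω, ξ' ω)) t P := iT.comp hF measurable_id
    have iG : IndepFun (fun ω => G (ξ ω, ξ' ω)) t P := iT.comp hG measurable_id
    have mF := iF.integral_fun_mul_eq_mul_integral hFi.1 hti.1
    have mG := iG.integral_fun_mul_eq_mul_integral hGi.1 hti.1
    have nF : Integrable (fun ω => F (ξ ω, ξ' ω) * t ω) P := iF.integrable_mul hFi hti
    have nG : Integrable (fun ω => G (ξ ω, ξ' ω) * t ω) P := iG.integrable_mul hGi hti
    have : ∀ ω, (if (B₀ ω = 1 ∧ (B₁ ω = 1 ∨ B₂ ω = 1)) ∨ (B₀ ω = 0 ∧ B₂ ω = 1)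
        then F (ξ ω, ξ' ω) else G (ξ ω, ξ' ω))
        = F (ξ ω, ξ' ω) * t ω + (G (ξ ω, ξ' ω) - G (ξ ω, ξ' ω) * t ω) := by
      intro ω
      rcases hB₀01 ω with h | h <;> rcases hB₁01 ω with h' | h' <;>
        rcases hB₂01 ω with h'' | h'' <;> simp [t, h, h', h'']
    simp_rw [this]
    rw [integral_add nF (by exact hGi.sub nG), integral_sub hGi nG, mF, mG, et]
    ring
  have law : ∀ f : (Fin D → ℝ) → ℝ, Measurable f → ∫ ω, f (ξ ω) ∂P = ∫ x, f x ∂H := by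
    intro f hf
    rw [← hξlaw, integral_map hξm.aemeasurable hf.aestronglyMeasurable]
  have law' : ∀ f : (Fin D → ℝ) → ℝ, Measurable f → ∫ ω, f (ξ' ω) ∂P = ∫ x, f x ∂H := by
    intro f hf
    rw [← hξ'law, integral_map hξ'm.aemeasurable hf.aestronglyMeasurable]
  have L : ∀ g, MemLp (fun ω => ξ ω g) 2 P := by
    intro g
    have := hH2 g
    rw [← hξlaw] at this
    exact this.comp_of_map hξm.aemeasurable
  have L' : ∀ g, MemLp (fun ω => ξ' ω g) 2 P := by
    intro g
    have := hH2 g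
    rw [← hξ'law] at this
    exact this.comp_of_map hξ'm.aemeasurable
  have I : ∀ g, Integrable (fun ω => ξ ω g) P := fun g => (L g).integrable (by norm_num)
  have I' : ∀ g, Integrable (fun ω => ξ' ω g) P := fun g => (L' g).integrable (by norm_num)
  have mg : ∀ g : Fin D, Measurable (fun x : Fin D → ℝ => x g) := fun g => measurable_pi_apply g
  have E1 : ∀ g, ∫ ω, μ ω g ∂P = ∫ x, x g ∂H := by
    intro g
    rw [hμ]
    exact law _ (mg g)
  have E2 : ∀ g, ∫ ω, μ' ω g ∂P = ∫ x, x g ∂H := by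
    intro g
    have k := key (fun q => q.1 g) (fun q => q.2 g) (by fun_prop) (by fun_prop) (I g) (I' g)
    have l1 := law _ (mg g)
    have l2 := law' _ (mg g)
    simp only [hμ', ite_apply]
    simp only at k
    rw [k, l1, l2]
    ring
  have E3 : ∀ g, ∫ ω, (μ' ω g) ^ 2 ∂P = ∫ x, x g * x g ∂H := by
    intro g
    have k := key (fun q => q.1 g * q.1 g) (fun q => q.2 g * q.2 g) (by fun_prop) (by fun_prop)
      ((L g).integrable_mul (L g)) ((L' g).integrable_mul (L' g))
    have l1 := law _ ((mg g).mul (mg g))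
    have l2 := law' _ ((mg g).mul (mg g))
    have : ∀ ω, (μ' ω g) ^ 2 =
      if (B₀ ω = 1 ∧ (B₁ ω = 1 ∨ B₂ ω = 1)) ∨ (B₀ ω = 0 ∧ B₂ ω = 1)
        then ξ ω g * ξ ω g else ξ' ω g * ξ' ω g := by
      intro ω
      rw [hμ']
      dsimp only
      split_ifs <;> ring
    simp_rw [this]
    simp only at k
    simp only [Pi.mul_apply] at l1 l2
    rw [k, l1, l2]
    ring
  have main : ∀ g g' : Fin D,
        ∫ ω, μ ω g * μ' ω g' ∂P - (∫ ω, μ ω g ∂P) * (∫ ω, μ' ω g' ∂P)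
          = p * CovH g g' := by
    intro g g'
    have k := key (fun q => q.1 g * q.1 g') (fun q => q.1 g * q.2 g') (by fun_prop) (by fun_prop)
      ((L g).integrable_mul (L g')) ((L g).integrable_mul (L' g'))
    have ig : IndepFun (fun ω => ξ ω g) (fun ω => ξ' ω g') P := i01.comp (mg g) (mg g')
    have l0 := ig.integral_fun_mul_eq_mul_integral (I g).1 (I' g').1
    have l1 := law _ ((mg g).mul (mg g'))
    have l2 := law _ (mg g)
    have l3 := law' _ (mg g')
    have : ∀ ω, μ ω g * μ' ω g' =
      if (B₀ ω = 1 ∧ (B₁ ω = 1 ∨ B₂ ω = 1)) ∨ (B₀ ω = 0 ∧ B₂ ω = 1)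
        then ξ ω g * ξ ω g' else ξ ω g * ξ' ω g' := by
      intro ω
      rw [hμ', hμ]
      dsimp only
      split_ifs <;> ring
    rw [E1, E2, hCovH]
    simp_rw [this]
    simp only at k
    simp only [Pi.mul_apply] at l1
    rw [k, l0, l1, l2, l3]
    ring
  have L2 : ∀ g, MemLp (fun ω => μ' ω g) 2 P := by
    intro g
    have hset : MeasurableSet {ω | (B₀ ω = 1 ∧ (B₁ ω = 1 ∨ B₂ ω = 1)) ∨ (B₀ ω = 0 ∧ B₂ ω = 1)} :=
      ((hB₀m (measurableSet_singleton 1)).inter ((hB₁m (measurableSet_singleton 1)).union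
        (hB₂m (measurableSet_singleton 1)))).union
        ((hB₀m (measurableSet_singleton 0)).inter (hB₂m (measurableSet_singleton 1)))
    have hm : Measurable μ' := by
      rw [hμ']
      exact Measurable.ite hset hξm hξ'm
    refine MemLp.of_le ((L g).norm.add (L' g).norm) ((mg g).comp hm).aestronglyMeasurable
      (Filter.Eventually.of_forall fun ω => ?_)
    rw [hμ']
    simp only [Pi.add_apply, Real.norm_eq_abs]
    rw [abs_of_nonneg (a := |ξ ω g| + |ξ' ω g|) (by positivity)]
    split_ifs
    · linarith [abs_nonneg (ξ' ω g)]
    · linarith [abs_nonneg (ξ ω g)]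
  have V1 : ∀ g, variance (fun ω => μ ω g) P = CovH g g := by
    intro g
    have l1 := law _ ((mg g).mul (mg g))
    simp only [Pi.mul_apply] at l1
    have e := E1 g
    rw [hμ] at e ⊢
    rw [variance_eq_sub (L g), hCovH, e, ← l1]
    simp [pow_two]
  have V2 : ∀ g, variance (fun ω => μ' ω g) P = CovH g g := by
    intro g
    rw [variance_eq_sub (L2 g), hCovH, E2, ← E3]
    simp [pow_two]
  rw [← hp]
  refine ⟨main, fun _ g g' => ?_⟩
  rw [main, V1, V2, mul_div_assoc]
end
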